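/- Let 0 < α < n and 1 < η < n/α, and let Ω be homogeneous of degree zero, have mean value zero on S^{n−1}, and be a Lipschitz function. There exists a constant C, independent of b, f, Q and x, such that for every b ∈ BMO(ℝ^n), every locally η-integrable function f for which the integrals below converge absolutely, every cube Q = Q(x₀, r) with center x₀, and every x ∈ Q: | T_{Ω,α}( (b − b_{2Q}) f χ_{(2Q)^c} )(x) − T_{Ω,α}( (b − b_{2Q}) f χ_{(2Q)^c} )(x₀) | ≤ C ‖b‖_{BMO} ( M_{αη}(|f|^η)(x) )^{1/η}, where 2Q is the cube concentric with Q of twice the side length and χ_{(2Q)^c} is the characteristic function of ℝ^n \ 2Q. -/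

import Mathlib

open MeasureTheory ENNReal Metric

noncomputable section

/-- The (closed) cube centered at `x` with side length `r`. -/
def cube {n : ℕ} (x : EuclideanSpace ℝ (Fin n)) (r : ℝ) : Set (EuclideanSpace ℝ (Fin n)) :=
  {y | ∀ i, |y i - x i| ≤ r / 2}

/-- The average `f_Q = |Q|⁻¹ ∫_Q f` of `f` over a set `Q`. -/
def setAvg {n : ℕ} (Q : Set (EuclideanSpace ℝ (Fin n))) (f : EuclideanSpace ℝ (Fin n) → ℝ) : ℝ :=
  (volume Q).toReal⁻¹ * ∫ y in Q, f y

/-- Slice norm of an `ℝ≥0∞`-valued function. -/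
def sliceNormE {n : ℕ} (p q t : ℝ) (g : EuclideanSpace ℝ (Fin n) → ℝ≥0∞) : ℝ≥0∞ :=
  (∫⁻ x, ((volume (cube x t))⁻¹ * ∫⁻ y in cube x t, g y ^ p) ^ (q / p)) ^ (1 / q)

/-- The slice space norm `‖f‖_{(E_p^q)_t}`. -/
def sliceNorm {n : ℕ} (p q t : ℝ) (f : EuclideanSpace ℝ (Fin n) → ℝ) : ℝ≥0∞ :=
  sliceNormE p q t fun y => ENNReal.ofReal |f y|

/-- Membership in the slice space `(E_p^q)_t(ℝⁿ)`. -/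
def MemSlice {n : ℕ} (p q t : ℝ) (f : EuclideanSpace ℝ (Fin n) → ℝ) : Prop :=
  Measurable f ∧ sliceNorm p q t f ≠ ∞

/-- The BMO seminorm, as a supremum over all cubes. -/
def bmoNorm {n : ℕ} (b : EuclideanSpace ℝ (Fin n) → ℝ) : ℝ≥0∞ :=
  ⨆ (x : EuclideanSpace ℝ (Fin n)) (r : ℝ) (_ : 0 < r),
    (volume (cube x r))⁻¹ * ∫⁻ y in cube x r, ENNReal.ofReal |b y - setAvg (cube x r) b|

/-- Membership in `BMO(ℝⁿ)`. -/
def MemBMO {n : ℕ} (b : EuclideanSpace ℝ (Fin n) → ℝ) : Prop :=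
  LocallyIntegrable b volume ∧ bmoNorm b ≠ ∞

/-- `Ω` is homogeneous of degree zero. -/
def HomogZero {n : ℕ} (Ω : EuclideanSpace ℝ (Fin n) → ℝ) : Prop :=
  ∀ lam : ℝ, 0 < lam → ∀ x : EuclideanSpace ℝ (Fin n), x ≠ 0 → Ω (lam • x) = Ω x

/-- `Ω` has mean value zero on the unit sphere. -/
def MeanZeroOnSphere {n : ℕ} (Ω : EuclideanSpace ℝ (Fin n) → ℝ) : Prop :=
  ∫ x : sphere (0 : EuclideanSpace ℝ (Fin n)) 1, Ω x
    ∂((volume : Measure (EuclideanSpace ℝ (Fin n))).toSphere) = 0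

/-- The fractional integral operator with rough kernel,
`T_{Ω,α} f (x) = ∫ Ω(x-y) |x-y|^{α-n} f(y) dy`. -/
def fracInt {n : ℕ} (Ω : EuclideanSpace ℝ (Fin n) → ℝ) (α : ℝ)
    (f : EuclideanSpace ℝ (Fin n) → ℝ) (x : EuclideanSpace ℝ (Fin n)) : ℝ :=
  ∫ y, Ω (x - y) * ‖x - y‖ ^ (α - n) * f y

/-- The commutator `[b, T_{Ω,α}] f = b ⬝ T_{Ω,α} f - T_{Ω,α}(b f)`. -/
def commutatorOp {n : ℕ} (Ω : EuclideanSpace ℝ (Fin n) → ℝ) (α : ℝ)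
    (b f : EuclideanSpace ℝ (Fin n) → ℝ) : EuclideanSpace ℝ (Fin n) → ℝ :=
  fun x => b x * fracInt Ω α f x - fracInt Ω α (fun y => b y * f y) x

/-- The fractional maximal operator `M_γ` (over cubes); `γ = 0` gives the
Hardy–Littlewood maximal operator. -/
def fracMax {n : ℕ} (γ : ℝ) (f : EuclideanSpace ℝ (Fin n) → ℝ)
    (x : EuclideanSpace ℝ (Fin n)) : ℝ≥0∞ :=
  ⨆ (z : EuclideanSpace ℝ (Fin n)) (r : ℝ) (_ : 0 < r) (_ : x ∈ cube z r),
    volume (cube z r) ^ (γ / n - 1) * ∫⁻ y in cube z r, ENNReal.ofReal |f y|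

/-- The Fefferman–Stein sharp maximal operator `M^♯`. -/
def sharpMax {n : ℕ} (f : EuclideanSpace ℝ (Fin n) → ℝ)
    (x : EuclideanSpace ℝ (Fin n)) : ℝ≥0∞ :=
  ⨆ (z : EuclideanSpace ℝ (Fin n)) (r : ℝ) (_ : 0 < r) (_ : x ∈ cube z r),
    (volume (cube z r))⁻¹ * ∫⁻ y in cube z r, ENNReal.ofReal |f y - setAvg (cube z r) f|

/-- The `L^p` norm. -/
def lpNorm {n : ℕ} (p : ℝ) (f : EuclideanSpace ℝ (Fin n) → ℝ) : ℝ≥0∞ :=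
  (∫⁻ x, ENNReal.ofReal |f x| ^ p) ^ (1 / p)

/-- The set of admissible Hölder–Lipschitz constants of order `β` for `b`. -/
def LipConstSet {n : ℕ} (β : ℝ) (b : EuclideanSpace ℝ (Fin n) → ℝ) : Set ℝ :=
  {C : ℝ | ∀ x y, |b x - b y| ≤ C * dist x y ^ β}

/-- Membership in the Lipschitz space `Lip_β(ℝⁿ)`. -/
def MemLip {n : ℕ} (β : ℝ) (b : EuclideanSpace ℝ (Fin n) → ℝ) : Prop :=
  (LipConstSet β b).Nonempty

/-- The `Lip_β` norm: the least admissible constant. -/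
def lipNorm {n : ℕ} (β : ℝ) (b : EuclideanSpace ℝ (Fin n) → ℝ) : ℝ :=
  sInf (LipConstSet β b)


section JohnNirenberg

open Filter Topology Module

theorem enorm_setAverage_sub_le {X : Type*} [MeasurableSpace X] {ν : Measure X} {S : Set X}
    {b : X → ℝ} (hb : IntegrableOn b S ν) (h0 : ν S ≠ 0) (h1 : ν S ≠ ∞) (c : ℝ) :
    ‖(⨍ z in S, b z ∂ν) - c‖ₑ ≤ (ν S)⁻¹ * ∫⁻ z in S, ‖b z - c‖ₑ ∂ν := by
  have hfin : IsFiniteMeasure (ν.restrict S) := ⟨by simpa using h1.lt_top⟩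
  have hne : NeZero (ν.restrict S) := ⟨by simpa using h0⟩
  have e : (⨍ z in S, b z ∂ν) - c = ⨍ z in S, (b z - c) ∂ν := by
    conv_lhs => rw [← average_const (ν.restrict S) c]
    unfold average
    rw [integral_sub]
    · exact hb.integrable.smul_measure (by simpa using h0)
    · exact integrable_const _
  rw [e]
  calc _ ≤ ∫⁻ z, ‖b z - c‖ₑ ∂((ν.restrict S Set.univ)⁻¹ • ν.restrict S) :=
        enorm_integral_le_lintegral_enorm _
    _ = _ := by rw [lintegral_smul_measure]; simp

variable {E : Type*} [NormedAddCommGroup E] [MeasurableSpace E] {μ : Measure E}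
  {b : E → ℝ} {N : ℝ≥0∞}

/-- The mean oscillation of `b` over every ball is at most `N`. -/
def OscillationLE (μ : Measure E) (b : E → ℝ) (N : ℝ≥0∞) : Prop :=
  ∀ x s, 0 < s →
    ∫⁻ y in closedBall x s, ‖b y - ⨍ z in closedBall x s, b z ∂μ‖ₑ ∂μ ≤ N * μ (closedBall x s)

/-- The supremum over all balls of the mean of `min (|b - b_B|) T ^ p`. -/
def truncatedOscillation (μ : Measure E) (b : E → ℝ) (p : ℝ) (T : ℝ≥0∞) : ℝ≥0∞ :=
  ⨆ (x : E) (s : ℝ) (_ : 0 < s), (μ (closedBall x s))⁻¹ *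
    ∫⁻ y in closedBall x s, (min ‖b y - ⨍ z in closedBall x s, b z ∂μ‖ₑ T) ^ p ∂μ

theorem truncatedOscillation_le {p : ℝ} (hp : 0 ≤ p) (T : ℝ≥0∞) :
    truncatedOscillation μ b p T ≤ T ^ p := by
  refine iSup_le fun x => iSup_le fun s => iSup_le fun hs => ?_
  calc _ ≤ (μ (closedBall x s))⁻¹ * ∫⁻ y in closedBall x s, T ^ p ∂μ := by
        gcongr
        exact min_le_right _ _
    _ ≤ T ^ p * ((μ (closedBall x s))⁻¹ * μ (closedBall x s)) := by
        rw [setLIntegral_const]; exact le_of_eq (by ring)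
    _ ≤ T ^ p * 1 := by gcongr; exact ENNReal.inv_mul_le_one _
    _ = _ := mul_one _

variable [NormedSpace ℝ E] [FiniteDimensional ℝ E] [μ.IsAddHaarMeasure]

theorem OscillationLE.enorm_average_sub_le (hN : OscillationLE μ b N)
    (hb : LocallyIntegrable b μ) {x y : E} {r s : ℝ} (hr : 0 < r) (hs : 0 < s)
    (hsub : closedBall y s ⊆ closedBall x r) {K : ℝ≥0∞}
    (hK : μ (closedBall x r) ≤ K * μ (closedBall y s)) :
    ‖(⨍ z in closedBall y s, b z ∂μ) - ⨍ z in closedBall x r, b z ∂μ‖ₑ ≤ K * N := by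
  have h0 : μ (closedBall y s) ≠ 0 := (measure_closedBall_pos μ y hs).ne'
  have h1 : μ (closedBall y s) ≠ ∞ := measure_closedBall_lt_top.ne
  refine (enorm_setAverage_sub_le (hb.integrableOn_isCompact (isCompact_closedBall _ _))
    h0 h1 _).trans ?_
  calc _ ≤ (μ (closedBall y s))⁻¹ * (N * (K * μ (closedBall y s))) := by
        gcongr
        exact (lintegral_mono_set hsub).trans ((hN x r hr).trans (by gcongr))
    _ = K * N * ((μ (closedBall y s))⁻¹ * μ (closedBall y s)) := by ring
    _ = K * N := by rw [ENNReal.inv_mul_cancel h0 h1, mul_one]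

theorem lintegral_min_rpow_le {p : ℝ} {T : ℝ≥0∞} (x : E) {s : ℝ} (hs : 0 < s) :
    ∫⁻ y in closedBall x s, (min ‖b y - ⨍ z in closedBall x s, b z ∂μ‖ₑ T) ^ p ∂μ
      ≤ truncatedOscillation μ b p T * μ (closedBall x s) := by
  have h0 : μ (closedBall x s) ≠ 0 := (measure_closedBall_pos μ x hs).ne'
  have h1 : μ (closedBall x s) ≠ ∞ := measure_closedBall_lt_top.ne
  rw [← ENNReal.div_le_iff h0 h1, ENNReal.div_eq_inv_mul]
  exact le_iSup_of_le x (le_iSup_of_le s (le_iSup_of_le hs le_rfl))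

variable [BorelSpace E]

theorem addHaar_closedBall_scale (x y : E) {c s : ℝ} (hc : 0 ≤ c) (hs : 0 ≤ s) :
    μ (closedBall x (c * s)) = ENNReal.ofReal c ^ finrank ℝ E * μ (closedBall y s) := by
  rw [Measure.addHaar_closedBall μ x (mul_nonneg hc hs), Measure.addHaar_closedBall μ y hs,
    mul_pow, ENNReal.ofReal_mul (by positivity), ENNReal.ofReal_pow hc, mul_assoc]

theorem OscillationLE.enorm_average_double_sub_le (hN : OscillationLE μ b N)
    (hb : LocallyIntegrable b μ) {x y : E} {r : ℝ} (hr : 0 < r) (hy : y ∈ closedBall x r) :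
    ‖(⨍ z in closedBall y r, b z ∂μ) - ⨍ z in closedBall x (2 * r), b z ∂μ‖ₑ
      ≤ 2 ^ finrank ℝ E * N := by
  refine hN.enorm_average_sub_le hb (by positivity) hr
    (closedBall_subset_closedBall' (by rw [mem_closedBall] at hy; linarith)) ?_
  rw [addHaar_closedBall_scale x y (by norm_num) hr.le]
  simp

/-- Stopping-time selection: outside a family of balls of small total measure, `|b - b_B|` is at
most `lam`, and the averages of `b` over these balls differ from `b_B` by at most `lam`. -/
theorem OscillationLE.exists_stopping_balls (hN : OscillationLE μ b N)
    (hb : LocallyIntegrable b μ) (x : E) {r : ℝ} (hr : 0 < r)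
    {lam : ℝ≥0∞} (hlam : 2 * (2 ^ finrank ℝ E * N) ≤ lam) :
    ∃ (u : Set E) (ρ : E → ℝ), u.Countable ∧ (∀ y ∈ u, 0 < ρ y) ∧
      (∀ y ∈ u, ‖(⨍ z in closedBall y (5 * ρ y), b z ∂μ)
        - ⨍ z in closedBall x r, b z ∂μ‖ₑ ≤ lam) ∧
      (∀ᵐ y ∂μ, y ∈ closedBall x r → lam < ‖b y - ⨍ z in closedBall x r, b z ∂μ‖ₑ →
        ∃ w ∈ u, y ∈ closedBall w (5 * ρ w)) ∧
      lam * ∑' y : u, μ (closedBall (y : E) (ρ y))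
        ≤ 2 * 4 ^ finrank ℝ E * N * μ (closedBall x r) := by
  classical
  set m := ⨍ z in closedBall x r, b z ∂μ with hm
  let sc : ℕ → ℝ := fun k => r * (5⁻¹) ^ k
  have hsc : ∀ k, 0 < sc k := fun k => by positivity
  let bad : E → ℕ → Prop := fun y k => lam < ‖(⨍ z in closedBall y (sc k), b z ∂μ) - m‖ₑ
  let t : Set E := {y | y ∈ closedBall x r ∧ ∃ k, bad y k}
  let κ : E → ℕ := fun y => if h : ∃ k, bad y k then Nat.find h else 0
  have hκ : ∀ y ∈ t, bad y (κ y) := by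
    rintro y ⟨-, h⟩
    simp only [κ, dif_pos h]; exact Nat.find_spec h
  have hκ' : ∀ y ∈ t, ∀ k < κ y, ¬ bad y k := by
    rintro y ⟨-, h⟩ k hk
    simp only [κ, dif_pos h] at hk; exact Nat.find_min h hk
  have hmm : ‖m - ⨍ z in closedBall x (2 * r), b z ∂μ‖ₑ ≤ 2 ^ finrank ℝ E * N :=
    hN.enorm_average_double_sub_le hb hr (mem_closedBall_self hr.le)
  have hκ0 : ∀ y ∈ t, κ y ≠ 0 := by
    intro y hy h0
    have := hκ y hy
    rw [h0] at this
    simp only [bad, sc, pow_zero, mul_one] at this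
    refine absurd (this.trans_le ?_) (lt_irrefl _)
    refine le_trans ?_ hlam
    calc _ = ‖((⨍ z in closedBall y r, b z ∂μ) - ⨍ z in closedBall x (2 * r), b z ∂μ)
          - (m - ⨍ z in closedBall x (2 * r), b z ∂μ)‖ₑ := by congr 1; ring
      _ ≤ _ := enorm_sub_le
      _ ≤ 2 ^ finrank ℝ E * N + 2 ^ finrank ℝ E * N :=
          add_le_add (hN.enorm_average_double_sub_le hb hr hy.1) hmm
      _ = _ := by ring
  let ρ : E → ℝ := fun y => sc (κ y)
  obtain ⟨u, hut, hdisj, hcov⟩ :=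
    Vitali.exists_disjoint_subfamily_covering_enlargement_closedBall t id ρ r (by
      intro y _
      exact mul_le_of_le_one_right hr.le (pow_le_one₀ (by norm_num) (by norm_num))) 5 (by norm_num)
  have hcount : u.Countable := hdisj.countable_of_nonempty_interior (fun y _ =>
    ⟨y, ball_subset_interior_closedBall (mem_ball_self (hsc _))⟩)
  refine ⟨u, ρ, hcount, fun y _ => hsc _, ?_, ?_, ?_⟩
  · intro y hy
    have h0 := hκ0 y (hut hy)
    have := hκ' y (hut hy) (κ y - 1) (by omega)
    have e : 5 * ρ y = sc (κ y - 1) := by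
      simp only [ρ, sc]
      obtain ⟨k, hk⟩ := Nat.exists_eq_succ_of_ne_zero h0
      rw [hk]; simp only [Nat.succ_eq_add_one, Nat.add_sub_cancel, pow_succ]; ring
    rw [e]
    exact not_lt.1 this
  · filter_upwards [IsUnifLocDoublingMeasure.ae_tendsto_average μ hb 1] with y hy hyx hlt
    have hlim : Tendsto sc atTop (𝓝[>] 0) := by
      refine tendsto_nhdsWithin_iff.2 ⟨?_, Eventually.of_forall fun k => hsc k⟩
      simpa [sc] using (tendsto_pow_atTop_nhds_zero_of_lt_one (r := (5⁻¹ : ℝ)) (by norm_num)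
        (by norm_num)).const_mul r
    have h1 := hy (fun _ => y) sc hlim
      (Eventually.of_forall fun k => mem_closedBall_self (by rw [one_mul]; exact (hsc k).le))
    have h2 := ((h1.sub_const m).enorm).eventually (lt_mem_nhds hlt)
    obtain ⟨k, hk⟩ := h2.exists
    obtain ⟨w, hw, hsub⟩ := hcov y ⟨hyx, k, hk⟩
    exact ⟨w, hw, hsub (mem_closedBall_self (hsc _).le)⟩
  · rw [← ENNReal.tsum_mul_left]
    calc _ ≤ ∑' y : u, ∫⁻ z in closedBall (y : E) (ρ y), ‖b z - m‖ₑ ∂μ := by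
          refine ENNReal.tsum_le_tsum fun y => ?_
          have h0 : μ (closedBall (y : E) (ρ y)) ≠ 0 := (measure_closedBall_pos μ _ (hsc _)).ne'
          have h1 : μ (closedBall (y : E) (ρ y)) ≠ ∞ := measure_closedBall_lt_top.ne
          rw [← ENNReal.le_div_iff_mul_le (Or.inl h0) (Or.inl h1), ENNReal.div_eq_inv_mul]
          exact (hκ y (hut y.2)).le.trans (enorm_setAverage_sub_le
            (hb.integrableOn_isCompact (isCompact_closedBall _ _)) h0 h1 _)
      _ = ∫⁻ z in ⋃ y ∈ u, closedBall (y : E) (ρ y), ‖b z - m‖ₑ ∂μ :=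
          (lintegral_biUnion hcount (fun _ _ => isClosed_closedBall.measurableSet) hdisj _).symm
      _ ≤ ∫⁻ z in closedBall x (2 * r), ‖b z - m‖ₑ ∂μ := by
          refine lintegral_mono_set (Set.iUnion₂_subset fun y hy => ?_)
          refine closedBall_subset_closedBall' ?_
          have h1 : dist y x ≤ r := (hut hy).1
          have h2 : ρ y ≤ r :=
            mul_le_of_le_one_right hr.le (pow_le_one₀ (by norm_num) (by norm_num))
          linarith
      _ ≤ ∫⁻ z in closedBall x (2 * r), (‖b z - ⨍ z in closedBall x (2 * r), b z ∂μ‖ₑ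
            + 2 ^ finrank ℝ E * N) ∂μ := by
          refine lintegral_mono fun z => ?_
          calc _ = ‖(b z - ⨍ z in closedBall x (2 * r), b z ∂μ)
                - (m - ⨍ z in closedBall x (2 * r), b z ∂μ)‖ₑ := by congr 1; ring
            _ ≤ _ := enorm_sub_le
            _ ≤ _ := by gcongr
      _ ≤ N * μ (closedBall x (2 * r)) + 2 ^ finrank ℝ E * N * μ (closedBall x (2 * r)) := by
          rw [lintegral_add_right _ measurable_const, setLIntegral_const]
          gcongr
          exact hN x _ (by positivity)
      _ ≤ 2 ^ finrank ℝ E * N * μ (closedBall x (2 * r))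
            + 2 ^ finrank ℝ E * N * μ (closedBall x (2 * r)) := by
          gcongr
          exact le_mul_of_one_le_left' (one_le_pow₀ (by norm_num))
      _ = _ := by
          rw [addHaar_closedBall_scale x x (by norm_num) hr.le,
            show (4 : ℝ≥0∞) = 2 * 2 by norm_num, mul_pow]
          simp only [ENNReal.ofReal_ofNat]
          ring

/-- The constant in the `L^p` John–Nirenberg inequality on a `D`-dimensional space. -/
def johnNirenbergConst (D : ℕ) (p : ℝ) : ℝ≥0∞ := 2 * 20 ^ D * 2 ^ p

theorem OscillationLE.truncatedOscillation_le (hN : OscillationLE μ b N)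
    (hb : LocallyIntegrable b μ) (hN0 : N ≠ 0) (hN1 : N ≠ ∞) {p : ℝ} (hp : 1 ≤ p)
    {T : ℝ≥0∞} (hT : T ≠ ∞) :
    truncatedOscillation μ b p T ≤ 3 * (johnNirenbergConst (finrank ℝ E) p * N) ^ p := by
  have hp0 : 0 ≤ p := by linarith
  set lam := johnNirenbergConst (finrank ℝ E) p * N with hlam
  set Φ := truncatedOscillation μ b p T with hΦ
  have h2p : (1 : ℝ≥0∞) ≤ 2 ^ p := ENNReal.one_le_rpow (by norm_num) (by linarith)
  have h2pt : (2 : ℝ≥0∞) ^ p ≠ ∞ := ENNReal.rpow_ne_top_of_nonneg hp0 (by norm_num)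
  have hlam_top : lam ≠ ∞ := by
    unfold lam johnNirenbergConst
    exact ENNReal.mul_ne_top (ENNReal.mul_ne_top (ENNReal.mul_ne_top (by norm_num)
      (ENNReal.pow_ne_top (by norm_num))) h2pt) hN1
  have hΦ_top : Φ ≠ ∞ := ne_top_of_le_ne_top (ENNReal.rpow_ne_top_of_nonneg hp0 hT)
    (_root_.truncatedOscillation_le hp0 T)
  have hlamp : lam ^ p ≠ ∞ := ENNReal.rpow_ne_top_of_nonneg hp0 hlam_top
  have hlam_ge : 2 * (2 ^ finrank ℝ E * N) ≤ lam := by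
    unfold lam johnNirenbergConst
    calc 2 * (2 ^ finrank ℝ E * N) = 2 * 2 ^ finrank ℝ E * 1 * N := by ring
      _ ≤ _ := by gcongr; norm_num
  have key : Φ ≤ lam ^ p + 2⁻¹ * (Φ + lam ^ p) := by
    refine iSup_le fun x => iSup_le fun r => iSup_le fun hr => ?_
    have h0 : μ (closedBall x r) ≠ 0 := (measure_closedBall_pos μ x hr).ne'
    have h1 : μ (closedBall x r) ≠ ∞ := measure_closedBall_lt_top.ne
    obtain ⟨u, ρ, hu, hρ, hav, hcov, hsum⟩ := hN.exists_stopping_balls hb x hr hlam_ge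
    rw [← ENNReal.div_eq_inv_mul, ENNReal.div_le_iff h0 h1]
    set m := ⨍ z in closedBall x r, b z ∂μ with hm
    have hsmall : 2 ^ p * ∑' y : u, μ (closedBall (y : E) (5 * ρ y)) ≤ μ (closedBall x r) := by
      have e : ∑' y : u, μ (closedBall (y : E) (5 * ρ y))
          = 5 ^ finrank ℝ E * ∑' y : u, μ (closedBall (y : E) (ρ y)) := by
        rw [← ENNReal.tsum_mul_left]
        refine tsum_congr fun y => ?_
        rw [addHaar_closedBall_scale _ (y : E) (by norm_num) (hρ y y.2).le]; simp
      rw [e]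
      have hc0 : 2 * 4 ^ finrank ℝ E * N ≠ 0 := by simp [hN0]
      have hc1 : 2 * 4 ^ finrank ℝ E * N ≠ ∞ := ENNReal.mul_ne_top (ENNReal.mul_ne_top
        (by norm_num) (ENNReal.pow_ne_top (by norm_num))) hN1
      rw [← ENNReal.mul_le_mul_iff_right hc0 hc1]
      refine le_trans (le_of_eq ?_) hsum
      rw [hlam, johnNirenbergConst, show (20 : ℝ≥0∞) = 4 * 5 by norm_num, mul_pow]
      ring
    have hae : ∀ᵐ y ∂μ, y ∈ closedBall x r → (min ‖b y - m‖ₑ T) ^ p ≤ lam ^ p +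
        (⋃ w ∈ u, closedBall w (5 * ρ w)).indicator (fun y => (min ‖b y - m‖ₑ T) ^ p) y := by
      filter_upwards [hcov] with y hy hyx
      by_cases h : lam < ‖b y - m‖ₑ
      · obtain ⟨w, hw, hyw⟩ := hy hyx h
        rw [Set.indicator_of_mem (Set.mem_iUnion₂.2 ⟨w, hw, hyw⟩)]
        exact le_add_self
      · refine le_add_right ?_
        gcongr
        exact (min_le_left _ _).trans (not_lt.1 h)
    have hU : MeasurableSet (⋃ w ∈ u, closedBall w (5 * ρ w)) :=
      MeasurableSet.biUnion hu fun _ _ => isClosed_closedBall.measurableSet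
    have hball : ∀ y : u, ∫⁻ z in closedBall (y : E) (5 * ρ y), (min ‖b z - m‖ₑ T) ^ p ∂μ
        ≤ 2⁻¹ * (Φ + lam ^ p) * (2 ^ p * μ (closedBall (y : E) (5 * ρ y))) := by
      intro y
      have h5 : 0 < 5 * ρ y := by have := hρ y y.2; positivity
      set my := ⨍ z in closedBall (y : E) (5 * ρ y), b z ∂μ with hmy
      calc _ ≤ ∫⁻ z in closedBall (y : E) (5 * ρ y),
            2 ^ (p - 1) * ((min ‖b z - my‖ₑ T) ^ p + lam ^ p) ∂μ := by
            refine lintegral_mono fun z => ?_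
            refine le_trans ?_ (ENNReal.rpow_add_le_mul_rpow_add_rpow _ _ hp)
            gcongr
            have : ‖b z - m‖ₑ ≤ ‖b z - my‖ₑ + lam := by
              calc _ = ‖(b z - my) + (my - m)‖ₑ := by congr 1; ring
                _ ≤ _ := enorm_add_le _ _
                _ ≤ _ := by gcongr; exact hav y y.2
            rcases le_total ‖b z - my‖ₑ T with h | h
            · rw [min_eq_left h]; exact (min_le_left _ _).trans this
            · rw [min_eq_right h]; exact (min_le_right _ _).trans le_self_add
        _ = 2 ^ (p - 1) * (∫⁻ z in closedBall (y : E) (5 * ρ y), (min ‖b z - my‖ₑ T) ^ p ∂μ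
              + lam ^ p * μ (closedBall (y : E) (5 * ρ y))) := by
            rw [lintegral_const_mul' _ _ (ENNReal.rpow_ne_top_of_nonneg (by linarith)
              (by norm_num)), lintegral_add_right _ measurable_const, setLIntegral_const]
        _ ≤ 2 ^ (p - 1) * (Φ * μ (closedBall (y : E) (5 * ρ y))
              + lam ^ p * μ (closedBall (y : E) (5 * ρ y))) := by
            gcongr
            exact lintegral_min_rpow_le _ h5
        _ = _ := by
            rw [ENNReal.rpow_sub _ _ (by norm_num) (by norm_num), ENNReal.rpow_one,
              ENNReal.div_eq_inv_mul]
            ring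
    calc _ ≤ ∫⁻ y in closedBall x r, (lam ^ p +
          (⋃ w ∈ u, closedBall w (5 * ρ w)).indicator (fun y => (min ‖b y - m‖ₑ T) ^ p) y) ∂μ :=
          lintegral_mono_ae ((ae_restrict_iff' isClosed_closedBall.measurableSet).2 hae)
      _ ≤ lam ^ p * μ (closedBall x r) +
            ∫⁻ y in ⋃ w ∈ u, closedBall w (5 * ρ w), (min ‖b y - m‖ₑ T) ^ p ∂μ := by
          rw [lintegral_add_left measurable_const, setLIntegral_const]
          refine add_le_add le_rfl ?_
          rw [← lintegral_indicator hU]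
          exact setLIntegral_le_lintegral _ _
      _ ≤ lam ^ p * μ (closedBall x r) +
            ∑' y : u, ∫⁻ z in closedBall (y : E) (5 * ρ y), (min ‖b z - m‖ₑ T) ^ p ∂μ := by
          gcongr
          have := hu.to_subtype
          rw [Set.biUnion_eq_iUnion]
          exact lintegral_iUnion_le _ _
      _ ≤ lam ^ p * μ (closedBall x r) + ∑' y : u,
            2⁻¹ * (Φ + lam ^ p) * (2 ^ p * μ (closedBall (y : E) (5 * ρ y))) := by
          gcongr with y
          exact hball y
      _ ≤ lam ^ p * μ (closedBall x r) + 2⁻¹ * (Φ + lam ^ p) * μ (closedBall x r) := by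
          rw [ENNReal.tsum_mul_left, ENNReal.tsum_mul_left]
          gcongr
      _ = _ := by ring
  lift Φ to NNReal using hΦ_top with Φ'
  generalize lam ^ p = l at *
  lift l to NNReal using hlamp
  rw [show (2⁻¹ : ℝ≥0∞) = ((2⁻¹ : NNReal) : ℝ≥0∞) by simp] at key
  norm_cast at key ⊢
  rw [← NNReal.coe_le_coe] at key ⊢
  push_cast at key ⊢
  linarith

/-- The `L^p` form of the John–Nirenberg inequality. -/
theorem OscillationLE.lintegral_rpow_le (hN : OscillationLE μ b N)
    (hb : LocallyIntegrable b μ) (hN1 : N ≠ ∞) {p : ℝ} (hp : 1 ≤ p) (x : E) {r : ℝ}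
    (hr : 0 < r) :
    ∫⁻ y in closedBall x r, ‖b y - ⨍ z in closedBall x r, b z ∂μ‖ₑ ^ p ∂μ
      ≤ 3 * (johnNirenbergConst (finrank ℝ E) p * N) ^ p * μ (closedBall x r) := by
  have hp0 : 0 < p := by linarith
  have hmeas : AEMeasurable (fun y => ‖b y - ⨍ z in closedBall x r, b z ∂μ‖ₑ)
      (μ.restrict (closedBall x r)) :=
    (hb.aestronglyMeasurable.restrict.aemeasurable.sub_const _).enorm
  rcases eq_or_ne N 0 with rfl | hN0
  · have h := hN x r hr
    rw [zero_mul, nonpos_iff_eq_zero, lintegral_eq_zero_iff' hmeas] at h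
    refine le_trans (le_of_eq ?_) zero_le
    rw [lintegral_eq_zero_iff' (hmeas.pow_const p)]
    filter_upwards [h] with y hy
    simp only [Pi.zero_apply] at hy ⊢
    rw [hy, ENNReal.zero_rpow_of_pos hp0]
  have hlim : ∀ y, Tendsto (fun k : ℕ => (min ‖b y - ⨍ z in closedBall x r, b z ∂μ‖ₑ k) ^ p)
      atTop (𝓝 (‖b y - ⨍ z in closedBall x r, b z ∂μ‖ₑ ^ p)) := by
    intro y
    refine ((ENNReal.continuous_rpow_const).tendsto _).comp ?_
    have := (tendsto_const_nhds (x := ‖b y - ⨍ z in closedBall x r, b z ∂μ‖ₑ)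
      (f := atTop)).min ENNReal.tendsto_nat_nhds_top
    simpa using this
  refine le_of_tendsto' (lintegral_tendsto_of_tendsto_of_monotone (fun k : ℕ =>
    (hmeas.min aemeasurable_const).pow_const p) (ae_of_all _ fun y i j hij => ?_)
    (ae_of_all _ hlim)) fun k => ?_
  · dsimp only
    gcongr
  · refine (lintegral_min_rpow_le x hr).trans ?_
    gcongr
    exact hN.truncatedOscillation_le hb hN0 hN1 hp (ENNReal.natCast_ne_top k)

end JohnNirenberg

section Cube

open Module Filter Topology

variable {n : ℕ}

theorem cube_eq_preimage (x : EuclideanSpace ℝ (Fin n)) {r : ℝ} (hr : 0 ≤ r) :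
    cube x r = WithLp.ofLp ⁻¹' closedBall (WithLp.ofLp x) (r / 2) := by
  ext y
  simp [cube, dist_pi_le_iff (by positivity : 0 ≤ r / 2), Real.dist_eq]

theorem isClosed_cube (x : EuclideanSpace ℝ (Fin n)) (r : ℝ) : IsClosed (cube x r) := by
  simp only [cube, Set.ofPred_forall]
  exact isClosed_iInter fun i => isClosed_le (by fun_prop) continuous_const

theorem cube_subset_cube (x : EuclideanSpace ℝ (Fin n)) {r s : ℝ} (h : r ≤ s) :
    cube x r ⊆ cube x s := fun y hy i => (hy i).trans (by linarith)

theorem measurePreserving_equivToLp :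
    MeasurePreserving (MeasurableEquiv.toLp 2 (Fin n → ℝ)) volume volume :=
  PiLp.volume_preserving_toLp (Fin n)

theorem preimage_cube (x : EuclideanSpace ℝ (Fin n)) {r : ℝ} (hr : 0 ≤ r) :
    MeasurableEquiv.toLp 2 (Fin n → ℝ) ⁻¹' cube x r
      = closedBall (WithLp.ofLp x) (r / 2) := by
  rw [cube_eq_preimage x hr]; rfl

theorem volume_cube_eq_closedBall (x : EuclideanSpace ℝ (Fin n)) {r : ℝ} (hr : 0 ≤ r) :
    volume (cube x r) = volume (closedBall (WithLp.ofLp x) (r / 2)) := by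
  rw [← preimage_cube x hr, measurePreserving_equivToLp.measure_preimage_equiv]

theorem volume_cube (x : EuclideanSpace ℝ (Fin n)) {r : ℝ} (hr : 0 ≤ r) :
    volume (cube x r) = ENNReal.ofReal r ^ n := by
  rw [volume_cube_eq_closedBall x hr, Real.volume_pi_closedBall _ (by positivity),
    ENNReal.ofReal_pow (by positivity)]
  simp [mul_div_cancel₀]

theorem setLIntegral_cube (F : EuclideanSpace ℝ (Fin n) → ℝ≥0∞)
    (x : EuclideanSpace ℝ (Fin n)) {r : ℝ} (hr : 0 ≤ r) :
    ∫⁻ y in cube x r, F y = ∫⁻ y in closedBall (WithLp.ofLp x) (r / 2), F (WithLp.toLp 2 y) := by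
  rw [← preimage_cube x hr]
  exact (measurePreserving_equivToLp.setLIntegral_comp_preimage_emb
    (MeasurableEquiv.measurableEmbedding _) F _).symm

theorem setAvg_cube (b : EuclideanSpace ℝ (Fin n) → ℝ) (x : EuclideanSpace ℝ (Fin n)) {r : ℝ}
    (hr : 0 ≤ r) :
    setAvg (cube x r) b = ⨍ y in closedBall (WithLp.ofLp x) (r / 2), b (WithLp.toLp 2 y) := by
  rw [setAvg, volume_cube_eq_closedBall x hr, setAverage_eq, smul_eq_mul, Measure.real,
    ← preimage_cube x hr]
  congr 1
  exact (measurePreserving_equivToLp.setIntegral_preimage_emb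
    (MeasurableEquiv.measurableEmbedding _) b _).symm

theorem locallyIntegrable_comp_toLp {b : EuclideanSpace ℝ (Fin n) → ℝ}
    (hb : LocallyIntegrable b volume) :
    LocallyIntegrable (fun y : Fin n → ℝ => b (WithLp.toLp 2 y)) volume := by
  rw [locallyIntegrable_iff]
  intro K hK
  have h1 : IsCompact (MeasurableEquiv.toLp 2 (Fin n → ℝ) '' K) :=
    hK.image (PiLp.continuous_toLp 2 _)
  have h2 := (measurePreserving_equivToLp.integrableOn_image
    (MeasurableEquiv.measurableEmbedding _)).1 (hb.integrableOn_isCompact h1)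
  exact h2

theorem oscillationLE_bmoNorm (b : EuclideanSpace ℝ (Fin n) → ℝ) :
    OscillationLE volume (fun y : Fin n → ℝ => b (WithLp.toLp 2 y)) (bmoNorm b) := by
  intro x s hs
  have h0 : volume (closedBall x s) ≠ 0 := (measure_closedBall_pos volume x hs).ne'
  have h1 : volume (closedBall x s) ≠ ∞ := measure_closedBall_lt_top.ne
  rw [← ENNReal.div_le_iff h0 h1, ENNReal.div_eq_inv_mul]
  refine le_iSup_of_le (WithLp.toLp 2 x) (le_iSup_of_le (2 * s) (le_iSup_of_le (by positivity) ?_))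
  have h2 : (0 : ℝ) ≤ 2 * s := by positivity
  rw [setLIntegral_cube _ _ h2, setAvg_cube _ _ h2, volume_cube_eq_closedBall _ h2]
  simp [Real.enorm_eq_ofReal_abs]

theorem lintegral_cube_rpow_le {b : EuclideanSpace ℝ (Fin n) → ℝ} (hb : MemBMO b) {p : ℝ}
    (hp : 1 ≤ p) (x : EuclideanSpace ℝ (Fin n)) {r : ℝ} (hr : 0 < r) :
    ∫⁻ y in cube x r, ‖b y - setAvg (cube x r) b‖ₑ ^ p
      ≤ 3 * (johnNirenbergConst n p * bmoNorm b) ^ p * volume (cube x r) := by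
  rw [setLIntegral_cube _ _ hr.le, setAvg_cube _ _ hr.le, volume_cube_eq_closedBall _ hr.le]
  have := (oscillationLE_bmoNorm b).lintegral_rpow_le (locallyIntegrable_comp_toLp hb.1) hb.2 hp
    (WithLp.ofLp x) (half_pos hr)
  simpa using this

theorem enorm_setAvg_dilate_sub_le {b : EuclideanSpace ℝ (Fin n) → ℝ} (hb : MemBMO b)
    (x : EuclideanSpace ℝ (Fin n)) {r : ℝ} (hr : 0 < r) (k : ℕ) :
    ‖setAvg (cube x (2 ^ k * r)) b - setAvg (cube x r) b‖ₑ ≤ k * (2 ^ n * bmoNorm b) := by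
  induction k with
  | zero => simp
  | succ k ih =>
    have h1 : ‖setAvg (cube x (2 ^ k * r)) b - setAvg (cube x (2 ^ (k + 1) * r)) b‖ₑ
        ≤ 2 ^ n * bmoNorm b := by
      rw [setAvg_cube _ _ (by positivity), setAvg_cube _ _ (by positivity)]
      have := (oscillationLE_bmoNorm b).enorm_average_double_sub_le
        (locallyIntegrable_comp_toLp hb.1) (x := WithLp.ofLp x) (y := WithLp.ofLp x)
        (r := 2 ^ k * r / 2) (by positivity) (mem_closedBall_self (by positivity))
      rw [show 2 ^ (k + 1) * r / 2 = 2 * (2 ^ k * r / 2) by ring]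
      simpa using this
    calc _ = ‖(setAvg (cube x (2 ^ k * r)) b - setAvg (cube x r) b) -
          (setAvg (cube x (2 ^ k * r)) b - setAvg (cube x (2 ^ (k + 1) * r)) b)‖ₑ := by
          congr 1; ring
      _ ≤ _ := enorm_sub_le
      _ ≤ k * (2 ^ n * bmoNorm b) + 2 ^ n * bmoNorm b := add_le_add ih h1
      _ = _ := by push_cast; ring

/-- The constant in the `L^p` bound for the oscillation of `b` over dilated cubes. -/
def dilatedOscillationConst (n : ℕ) (p : ℝ) : ℝ≥0∞ := 2 * (3 * johnNirenbergConst n p + 2 ^ n)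

theorem dilatedOscillationConst_ne_top (n : ℕ) {p : ℝ} (hp : 0 ≤ p) :
    dilatedOscillationConst n p ≠ ∞ := by
  have h : (2 : ℝ≥0∞) ^ p ≠ ∞ := ENNReal.rpow_ne_top_of_nonneg hp (by norm_num)
  have h2 : ∀ a : ℕ, ((a : ℝ≥0∞) ^ n) ≠ ∞ := fun a => ENNReal.pow_ne_top (by simp)
  unfold dilatedOscillationConst johnNirenbergConst
  exact ENNReal.mul_ne_top (by norm_num) (ENNReal.add_ne_top.2
    ⟨ENNReal.mul_ne_top (by norm_num) (ENNReal.mul_ne_top (ENNReal.mul_ne_top (by norm_num)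
      (h2 20)) h), h2 2⟩)

theorem lintegral_dilate_rpow_le {b : EuclideanSpace ℝ (Fin n) → ℝ} (hb : MemBMO b) {p : ℝ}
    (hp : 1 ≤ p) (x : EuclideanSpace ℝ (Fin n)) {r : ℝ} (hr : 0 < r) (k : ℕ) :
    ∫⁻ y in cube x (2 ^ k * r), ‖b y - setAvg (cube x r) b‖ₑ ^ p
      ≤ (dilatedOscillationConst n p * (k + 1) * bmoNorm b) ^ p
        * volume (cube x (2 ^ k * r)) := by
  have hp0 : 0 ≤ p := by linarith
  set m := setAvg (cube x r) b
  set M := setAvg (cube x (2 ^ k * r)) b with hM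
  have h1 : ∀ y, ‖b y - m‖ₑ ^ p ≤ 2 ^ (p - 1) * (‖b y - M‖ₑ ^ p
      + (k * (2 ^ n * bmoNorm b)) ^ p) := by
    intro y
    refine le_trans ?_ (ENNReal.rpow_add_le_mul_rpow_add_rpow _ _ hp)
    gcongr
    calc _ = ‖(b y - M) + (M - m)‖ₑ := by congr 1; ring
      _ ≤ _ := enorm_add_le _ _
      _ ≤ _ := by gcongr; exact enorm_setAvg_dilate_sub_le hb x hr k
  have h3 : (3 : ℝ≥0∞) ≤ 3 ^ p := by
    calc (3 : ℝ≥0∞) = 3 ^ (1 : ℝ) := (ENNReal.rpow_one _).symm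
      _ ≤ _ := ENNReal.rpow_le_rpow_of_exponent_le (by norm_num) hp
  have hle : 2 * (3 * (johnNirenbergConst n p * bmoNorm b) + k * (2 ^ n * bmoNorm b))
      ≤ dilatedOscillationConst n p * (k + 1) * bmoNorm b := by
    unfold dilatedOscillationConst
    calc _ ≤ 2 * (3 * (johnNirenbergConst n p * bmoNorm b) + k * (2 ^ n * bmoNorm b))
          + 2 * (k * (3 * johnNirenbergConst n p) + 2 ^ n) * bmoNorm b := le_self_add
      _ = _ := by ring
  calc _ ≤ ∫⁻ y in cube x (2 ^ k * r), 2 ^ (p - 1) * (‖b y - M‖ₑ ^ p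
          + (k * (2 ^ n * bmoNorm b)) ^ p) := lintegral_mono h1
    _ = 2 ^ (p - 1) * ((∫⁻ y in cube x (2 ^ k * r), ‖b y - M‖ₑ ^ p)
          + (k * (2 ^ n * bmoNorm b)) ^ p * volume (cube x (2 ^ k * r))) := by
        rw [lintegral_const_mul' _ _ (ENNReal.rpow_ne_top_of_nonneg (by linarith)
          (by norm_num)), lintegral_add_right _ measurable_const, setLIntegral_const]
    _ ≤ 2 ^ p * (3 ^ p * (johnNirenbergConst n p * bmoNorm b) ^ p * volume (cube x (2 ^ k * r))
          + (k * (2 ^ n * bmoNorm b)) ^ p * volume (cube x (2 ^ k * r))) := by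
        gcongr
        · norm_num
        · linarith
        · refine (lintegral_cube_rpow_le hb hp x (by positivity)).trans ?_
          gcongr
    _ = (2 ^ p * ((3 * (johnNirenbergConst n p * bmoNorm b)) ^ p +
          (k * (2 ^ n * bmoNorm b)) ^ p)) * volume (cube x (2 ^ k * r)) := by
        rw [ENNReal.mul_rpow_of_nonneg 3 _ hp0]; ring
    _ ≤ (2 ^ p * (3 * (johnNirenbergConst n p * bmoNorm b) +
          k * (2 ^ n * bmoNorm b)) ^ p) * volume (cube x (2 ^ k * r)) := by
        gcongr
        exact ENNReal.add_rpow_le_rpow_add _ _ hp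
    _ ≤ _ := by
        rw [← ENNReal.mul_rpow_of_nonneg _ _ hp0]
        exact mul_le_mul' (ENNReal.rpow_le_rpow hle hp0) le_rfl

end Cube

section Kernel

theorem abs_rpow_sub_rpow_le {s ρ a b : ℝ} (hs : s ≤ 0) (hρ : 0 < ρ) (ha : ρ ≤ a) (hb : ρ ≤ b) :
    |a ^ s - b ^ s| ≤ -s * ρ ^ (s - 1) * |a - b| := by
  have := Convex.norm_image_sub_le_of_norm_hasDerivWithin_le (f := fun t : ℝ => t ^ s)
    (f' := fun t => s * t ^ (s - 1)) (s := Set.Ici ρ) (C := -s * ρ ^ (s - 1)) (x := b) (y := a)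
    (fun t ht => (Real.hasDerivAt_rpow_const
      (Or.inl (hρ.trans_le ht).ne')).hasDerivWithinAt) (fun t ht => ?_) (convex_Ici ρ) hb ha
  · simpa [Real.norm_eq_abs] using this
  · rw [norm_mul, Real.norm_eq_abs, Real.norm_eq_abs, abs_of_nonpos hs,
      abs_of_nonneg (Real.rpow_nonneg (hρ.le.trans ht) _)]
    exact mul_le_mul_of_nonneg_left
      (Real.rpow_le_rpow_of_nonpos hρ ht (by linarith)) (by linarith)

theorem norm_normalize_sub_le {E : Type*} [NormedAddCommGroup E] [NormedSpace ℝ E] {u v : E}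
    (hu : u ≠ 0) (hv : v ≠ 0) :
    ‖‖u‖⁻¹ • u - ‖v‖⁻¹ • v‖ ≤ 2 * ‖u - v‖ / ‖v‖ := by
  have hu' : 0 < ‖u‖ := norm_pos_iff.2 hu
  have hv' : 0 < ‖v‖ := norm_pos_iff.2 hv
  have e : ‖u‖⁻¹ • u - ‖v‖⁻¹ • v
      = ‖v‖⁻¹ • (u - v) + (‖v‖⁻¹ * (‖v‖ - ‖u‖)) • (‖u‖⁻¹ • u) := by
    rw [smul_smul, smul_sub]
    have : ‖v‖⁻¹ * (‖v‖ - ‖u‖) * ‖u‖⁻¹ = ‖u‖⁻¹ - ‖v‖⁻¹ := by field_simp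
    rw [this, sub_smul]; abel
  rw [e]
  refine (norm_add_le _ _).trans ?_
  have h1 : ‖‖u‖⁻¹ • u‖ = 1 := by
    rw [norm_smul, norm_inv, norm_norm, inv_mul_cancel₀ hu'.ne']
  rw [norm_smul (‖v‖⁻¹ * _), h1, norm_smul, norm_mul, norm_inv, norm_norm, Real.norm_eq_abs]
  have h2 : |‖v‖ - ‖u‖| ≤ ‖u - v‖ := by rw [abs_sub_comm]; exact abs_norm_sub_norm_le u v
  calc _ ≤ ‖v‖⁻¹ * ‖u - v‖ + ‖v‖⁻¹ * ‖u - v‖ * 1 := by gcongr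
    _ = _ := by ring

theorem HomogZero.exists_kernel_sub_le {n : ℕ} {Ω : EuclideanSpace ℝ (Fin n) → ℝ}
    (hhom : HomogZero Ω) {L : NNReal}
    (hlip : LipschitzOnWith L Ω (sphere (0 : EuclideanSpace ℝ (Fin n)) 1)) {s : ℝ} (hs : s ≤ 0) :
    ∃ A : ℝ, 0 ≤ A ∧ ∀ (u v : EuclideanSpace ℝ (Fin n)) (ρ : ℝ), 0 < ρ → ρ ≤ ‖u‖ → ρ ≤ ‖v‖ →
      |Ω u * ‖u‖ ^ s - Ω v * ‖v‖ ^ s| ≤ A * ‖u - v‖ * ρ ^ (s - 1) := by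
  obtain ⟨M, hM⟩ := (isCompact_sphere (0 : EuclideanSpace ℝ (Fin n)) 1).exists_bound_of_continuousOn
    hlip.continuousOn
  refine ⟨2 * L + |M| * -s, by have := abs_nonneg M; nlinarith [L.2], ?_⟩
  intro u v ρ hρ hu hv
  have hu' : 0 < ‖u‖ := hρ.trans_le hu
  have hv' : 0 < ‖v‖ := hρ.trans_le hv
  have hu0 : u ≠ 0 := norm_pos_iff.1 hu'
  have hv0 : v ≠ 0 := norm_pos_iff.1 hv'
  have sph : ∀ w : EuclideanSpace ℝ (Fin n), 0 < ‖w‖ → ‖w‖⁻¹ • w ∈ sphere (0 : EuclideanSpace ℝ (Fin n)) 1 := by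
    intro w hw
    simp [norm_smul, hw.ne']
  have e1 := hhom _ (inv_pos.2 hu') u hu0
  have e2 := hhom _ (inv_pos.2 hv') v hv0
  have hΩ : |Ω u - Ω v| ≤ L * (2 * ‖u - v‖ / ρ) := by
    rw [← e1, ← e2, ← Real.dist_eq]
    refine (hlip.dist_le_mul _ (sph u hu') _ (sph v hv')).trans ?_
    rw [dist_eq_norm]
    gcongr
    exact (norm_normalize_sub_le hu0 hv0).trans (by gcongr)
  have hΩv : |Ω v| ≤ |M| := by
    rw [← e2]; exact (hM _ (sph v hv')).trans (le_abs_self M)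
  have hpow : ‖u‖ ^ s ≤ ρ ^ s := Real.rpow_le_rpow_of_nonpos hρ hu hs
  have hdiff : |‖u‖ ^ s - ‖v‖ ^ s| ≤ -s * ρ ^ (s - 1) * ‖u - v‖ :=
    (abs_rpow_sub_rpow_le hs hρ hu hv).trans (mul_le_mul_of_nonneg_left
      (abs_norm_sub_norm_le u v) (mul_nonneg (by linarith) (Real.rpow_nonneg hρ.le _)))
  have hρs : ρ ^ s = ρ ^ (s - 1) * ρ := by
    rw [Real.rpow_sub_one hρ.ne']; field_simp
  calc |Ω u * ‖u‖ ^ s - Ω v * ‖v‖ ^ s|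
      = |(Ω u - Ω v) * ‖u‖ ^ s + Ω v * (‖u‖ ^ s - ‖v‖ ^ s)| := by congr 1; ring
    _ ≤ |Ω u - Ω v| * ‖u‖ ^ s + |Ω v| * |‖u‖ ^ s - ‖v‖ ^ s| := by
        refine (abs_add_le _ _).trans ?_
        rw [abs_mul, abs_mul, abs_of_nonneg (Real.rpow_nonneg hu'.le s)]
    _ ≤ L * (2 * ‖u - v‖ / ρ) * ρ ^ s + |M| * (-s * ρ ^ (s - 1) * ‖u - v‖) := by
        gcongr
    _ = _ := by rw [hρs]; field_simp

end Kernel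

section Estimate

variable {n : ℕ}

theorem EuclideanSpace.norm_le_card_mul_of_abs_le {v : EuclideanSpace ℝ (Fin n)} {c : ℝ}
    (hc : 0 ≤ c) (h : ∀ i, |v i| ≤ c) : ‖v‖ ≤ n * c := by
  rw [EuclideanSpace.norm_eq]
  refine Real.sqrt_le_iff.2 ⟨by positivity, ?_⟩
  calc ∑ i, ‖v i‖ ^ 2 ≤ ∑ _i : Fin n, c ^ 2 := by
        gcongr with i
        exact h i
    _ = n * c ^ 2 := by simp
    _ ≤ (n * n) * c ^ 2 := by
        gcongr
        exact_mod_cast Nat.le_mul_self n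
    _ = _ := by ring

theorem compl_cube_subset_iUnion (x : EuclideanSpace ℝ (Fin n)) {r : ℝ} (hr : 0 < r) :
    (cube x r)ᶜ ⊆ ⋃ k : ℕ, cube x (2 ^ (k + 1) * r) \ cube x (2 ^ k * r) := by
  classical
  intro y hy
  have hex : ∃ k : ℕ, y ∈ cube x (2 ^ k * r) := by
    obtain ⟨k, hk⟩ := pow_unbounded_of_one_lt (2 * ‖y - x‖ / r) (one_lt_two (α := ℝ))
    refine ⟨k, fun i => ?_⟩
    have h1 : |y i - x i| ≤ ‖y - x‖ := PiLp.norm_apply_le (y - x) i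
    rw [div_lt_iff₀ hr] at hk
    linarith
  have hne : Nat.find hex ≠ 0 := by
    intro h0
    have := Nat.find_spec hex
    rw [h0] at this
    simp only [pow_zero, one_mul] at this
    exact hy this
  obtain ⟨k, hk⟩ := Nat.exists_eq_succ_of_ne_zero hne
  refine Set.mem_iUnion.2 ⟨k, ?_, Nat.find_min hex (by omega)⟩
  have := Nat.find_spec hex
  rwa [hk] at this

/-- For `x ∈ Q(x₀, r)` and `y` outside a dilate of `2Q`, both `x - y` and `x₀ - y` are bounded
below by a multiple of the side length of that dilate, and their difference is at most `n * r`. -/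
theorem norm_bounds_of_mem_annulus {x₀ x y : EuclideanSpace ℝ (Fin n)} {r : ℝ} (hr : 0 < r)
    (hx : x ∈ cube x₀ r) {k : ℕ} (hy : y ∉ cube x₀ (2 ^ k * (2 * r))) :
    2 ^ (k + 1) * (2 * r) / 8 ≤ ‖x - y‖ ∧ 2 ^ (k + 1) * (2 * r) / 8 ≤ ‖x₀ - y‖ ∧
      ‖(x - y) - (x₀ - y)‖ ≤ n * r := by
  have hpow : (1 : ℝ) ≤ 2 ^ k := one_le_pow₀ (by norm_num)
  have hR : r ≤ 2 ^ k * r := le_mul_of_one_le_left hr.le hpow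
  simp only [cube, Set.mem_ofPred_eq, not_forall, not_le] at hy
  obtain ⟨i, hi⟩ := hy
  have hxi := hx i
  have h1 : |x i - y i| ≤ ‖x - y‖ := PiLp.norm_apply_le (x - y) i
  have h2 : |x₀ i - y i| ≤ ‖x₀ - y‖ := PiLp.norm_apply_le (x₀ - y) i
  have h3 : |y i - x₀ i| ≤ |x i - y i| + |x i - x₀ i| := by
    rw [abs_sub_comm (x i) (y i)]; exact abs_sub_le _ _ _
  rw [abs_sub_comm] at h2
  rw [pow_succ]
  refine ⟨by linarith, by linarith, ?_⟩
  refine EuclideanSpace.norm_le_card_mul_of_abs_le hr.le fun j => ?_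
  have := hx j
  simp only [PiLp.sub_apply, sub_sub_sub_cancel_right]
  linarith

theorem rpow_mul_lintegral_le_fracMax {α η : ℝ} (hη : 0 < η) (hn : 0 < n)
    (f : EuclideanSpace ℝ (Fin n) → ℝ) {x z : EuclideanSpace ℝ (Fin n)} {R : ℝ} (hR : 0 < R)
    (hx : x ∈ cube z R) :
    ENNReal.ofReal R ^ (α - n) * volume (cube z R) ^ (1 - 1 / η)
        * (∫⁻ y in cube z R, ‖f y‖ₑ ^ η) ^ (1 / η)
      ≤ (fracMax (α * η) (fun y => |f y| ^ η) x) ^ (1 / η) := by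
  have h0 : ENNReal.ofReal R ≠ 0 := by simpa using hR
  have h1 : ENNReal.ofReal R ≠ ∞ := ENNReal.ofReal_ne_top
  have hn' : (n : ℝ) ≠ 0 := by exact_mod_cast hn.ne'
  have e : ENNReal.ofReal R ^ (α - n) * volume (cube z R) ^ (1 - 1 / η)
      = (volume (cube z R) ^ (α * η / n - 1)) ^ (1 / η) := by
    rw [volume_cube z hR.le, ← ENNReal.rpow_natCast, ← ENNReal.rpow_mul, ← ENNReal.rpow_mul,
      ← ENNReal.rpow_mul, ← ENNReal.rpow_add _ _ h0 h1]
    congr 1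
    field_simp
    ring
  rw [e, ← ENNReal.mul_rpow_of_nonneg _ _ (by positivity)]
  gcongr
  refine le_iSup_of_le z (le_iSup_of_le R (le_iSup_of_le hR (le_iSup_of_le hx ?_)))
  gcongr with y
  rw [abs_of_nonneg (Real.rpow_nonneg (abs_nonneg _) _), Real.enorm_eq_ofReal_abs,
    ENNReal.ofReal_rpow_of_nonneg (abs_nonneg _) hη.le]

theorem lintegral_dilate_mul_le {b : EuclideanSpace ℝ (Fin n) → ℝ} (hb : MemBMO b)
    {f : EuclideanSpace ℝ (Fin n) → ℝ} (hf : Measurable f) {p η : ℝ} (hpη : p.HolderConjugate η)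
    (x : EuclideanSpace ℝ (Fin n)) {r : ℝ} (hr : 0 < r) (k : ℕ) :
    ∫⁻ y in cube x (2 ^ k * r), ‖b y - setAvg (cube x r) b‖ₑ * ‖f y‖ₑ
      ≤ dilatedOscillationConst n p * (k + 1) * bmoNorm b *
        (volume (cube x (2 ^ k * r)) ^ (1 - 1 / η) *
          (∫⁻ y in cube x (2 ^ k * r), ‖f y‖ₑ ^ η) ^ (1 / η)) := by
  have hp := hpη.lt
  have hp0 : 0 < p := by linarith
  have h1 : 1 / p = 1 - 1 / η := by
    have := hpη.inv_add_inv_eq_one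
    rw [one_div, one_div]; linarith
  refine (ENNReal.lintegral_mul_le_Lp_mul_Lq _ hpη
    (hb.1.aestronglyMeasurable.restrict.aemeasurable.sub_const _).enorm
    hf.enorm.aemeasurable).trans ?_
  rw [← mul_assoc]
  gcongr
  calc _ ≤ ((dilatedOscillationConst n p * (k + 1) * bmoNorm b) ^ p
        * volume (cube x (2 ^ k * r))) ^ (1 / p) := by
        gcongr
        exact lintegral_dilate_rpow_le hb hp.le x hr k
    _ = _ := by
        rw [ENNReal.mul_rpow_of_nonneg _ _ (by positivity), ← ENNReal.rpow_mul,
          mul_one_div_cancel hp0.ne', ENNReal.rpow_one, h1]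

theorem tsum_succ_mul_geometric_ne_top : ∑' k : ℕ, ((k : ℝ≥0∞) + 2) * 2⁻¹ ^ k ≠ ∞ := by
  have h : Summable fun k : ℕ => ((k : ℝ) + 2) * 2⁻¹ ^ k := by
    have h1 := summable_pow_mul_geometric_of_norm_lt_one 1 (r := (2⁻¹ : ℝ)) (by norm_num)
    have h2 := summable_geometric_of_lt_one (r := (2⁻¹ : ℝ)) (by norm_num) (by norm_num)
    refine (h1.add (h2.mul_left 2)).congr fun k => ?_
    rw [pow_one]; ring
  convert h.tsum_ofReal_ne_top using 4 with k
  rw [ENNReal.ofReal_mul (by positivity), ENNReal.ofReal_add (by positivity) (by norm_num),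
    ENNReal.ofReal_pow (by norm_num), ENNReal.ofReal_inv_of_pos (by norm_num)]
  simp

end Estimate

theorem statement14 (n : ℕ) (hn : 1 ≤ n) (α η : ℝ) (hα0 : 0 < α) (hαn : α < n)
    (hη1 : 1 < η) (hη : η < n / α)
    (Ω : EuclideanSpace ℝ (Fin n) → ℝ) (hhom : HomogZero Ω) (hmean : MeanZeroOnSphere Ω)
    (L : NNReal) (hlip : LipschitzOnWith L Ω (sphere (0 : EuclideanSpace ℝ (Fin n)) 1)) :
    ∃ C > (0 : ℝ), ∀ b : EuclideanSpace ℝ (Fin n) → ℝ, MemBMO b →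
      ∀ f : EuclideanSpace ℝ (Fin n) → ℝ, Measurable f → LocallyIntegrable (fun y => |f y| ^ η) volume →
      ∀ (x₀ : EuclideanSpace ℝ (Fin n)) (r : ℝ), 0 < r → ∀ x ∈ cube x₀ r,
      ∀ g : EuclideanSpace ℝ (Fin n) → ℝ,
        g = ((cube x₀ (2 * r))ᶜ.indicator fun y =>
              (b y - setAvg (cube x₀ (2 * r)) b) * f y) →
        Integrable (fun y => Ω (x - y) * ‖x - y‖ ^ (α - n) * g y) volume →
        Integrable (fun y => Ω (x₀ - y) * ‖x₀ - y‖ ^ (α - n) * g y) volume →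
        ENNReal.ofReal |fracInt Ω α g x - fracInt Ω α g x₀| ≤
          ENNReal.ofReal C * bmoNorm b * (fracMax (α * η) (fun y => |f y| ^ η) x) ^ (1 / η) := by
  have hη0 : 0 < η := by linarith
  have hpη : (Real.conjExponent η).HolderConjugate η := (Real.HolderConjugate.conjExponent hη1).symm
  set p := Real.conjExponent η
  have hs : α - n ≤ 0 := by linarith
  obtain ⟨A, hA0, hA⟩ := hhom.exists_kernel_sub_le hlip hs
  set A' : ℝ := A * n * 8 ^ (1 - (α - n)) with hA'
  have hA'0 : 0 ≤ A' := by positivity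
  set S : ℝ≥0∞ := ∑' k : ℕ, ((k : ℝ≥0∞) + 2) * 2⁻¹ ^ k with hS
  set C₀ : ℝ≥0∞ := ENNReal.ofReal A' * dilatedOscillationConst n p * S with hC₀
  have hC₀t : C₀ ≠ ∞ := ENNReal.mul_ne_top (ENNReal.mul_ne_top ENNReal.ofReal_ne_top
    (dilatedOscillationConst_ne_top n (zero_le_one.trans hpη.lt.le)))
    tsum_succ_mul_geometric_ne_top
  refine ⟨C₀.toReal + 1, by positivity, ?_⟩
  intro b hb f hf _ x₀ r hr x hx g hg hint hint₀
  have h2r : 0 < 2 * r := by positivity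
  set m := setAvg (cube x₀ (2 * r)) b with hm
  set I : EuclideanSpace ℝ (Fin n) → ℝ≥0∞ := fun y =>
    ‖Ω (x - y) * ‖x - y‖ ^ (α - n) - Ω (x₀ - y) * ‖x₀ - y‖ ^ (α - n)‖ₑ
      * (‖b y - m‖ₑ * ‖f y‖ₑ) with hI
  set Fm := (fracMax (α * η) (fun y => |f y| ^ η) x) ^ (1 / η) with hFm
  have hlayer : ∀ k : ℕ, ∫⁻ y in cube x₀ (2 ^ (k + 1) * (2 * r)) \ cube x₀ (2 ^ k * (2 * r)), I y
      ≤ ENNReal.ofReal A' * dilatedOscillationConst n p * bmoNorm b * Fm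
        * (((k : ℝ≥0∞) + 2) * 2⁻¹ ^ k) := by
    intro k
    set R : ℝ := 2 ^ (k + 1) * (2 * r) with hRdef
    have hR : 0 < R := by positivity
    have hrR : r ≤ R := by
      have : (1 : ℝ) ≤ 2 ^ (k + 1) := one_le_pow₀ (by norm_num)
      nlinarith
    have hker : ∀ y ∈ cube x₀ R \ cube x₀ (2 ^ k * (2 * r)),
        ‖Ω (x - y) * ‖x - y‖ ^ (α - n) - Ω (x₀ - y) * ‖x₀ - y‖ ^ (α - n)‖ₑ
          ≤ ENNReal.ofReal A' * 2⁻¹ ^ k * ENNReal.ofReal R ^ (α - n) := by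
      intro y hy
      obtain ⟨h1, h2, h3⟩ := norm_bounds_of_mem_annulus hr hx hy.2
      have h4 := hA (x - y) (x₀ - y) (R / 8) (by positivity) h1 h2
      have h5 : |Ω (x - y) * ‖x - y‖ ^ (α - n) - Ω (x₀ - y) * ‖x₀ - y‖ ^ (α - n)|
          ≤ A' * 2⁻¹ ^ k * R ^ (α - n) := by
        refine h4.trans ?_
        have e1 : (R / 8) ^ (α - n - 1) = R ^ (α - n) / R * 8 ^ (1 - (α - n)) := by
          rw [Real.div_rpow hR.le (by norm_num), Real.rpow_sub_one hR.ne',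
            show (1 - (α - n)) = -(α - n - 1) by ring, Real.rpow_neg (by norm_num : (0:ℝ) ≤ 8)]
          field_simp
        have e2 : r / R ≤ 2⁻¹ ^ k := by
          rw [hRdef, inv_pow, div_le_iff₀ (by positivity), pow_succ]
          have : (2 ^ k : ℝ) ≠ 0 := by positivity
          field_simp
          norm_num
        calc _ ≤ A * (n * r) * (R ^ (α - n) / R * 8 ^ (1 - (α - n))) := by
              rw [e1]; gcongr
          _ = A' * (r / R) * R ^ (α - n) := by rw [hA']; ring
          _ ≤ _ := by gcongr
      rw [Real.enorm_eq_ofReal_abs]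
      refine (ENNReal.ofReal_le_ofReal h5).trans (le_of_eq ?_)
      rw [ENNReal.ofReal_mul (by positivity), ENNReal.ofReal_mul hA'0,
        ENNReal.ofReal_pow (by norm_num), ENNReal.ofReal_inv_of_pos (by norm_num),
        ENNReal.ofReal_rpow_of_pos hR]
      simp
    have hRt : ENNReal.ofReal R ^ (α - n) ≠ ∞ :=
      ENNReal.rpow_ne_top_of_ne_zero (by simpa using hR) ENNReal.ofReal_ne_top
    calc _ ≤ ∫⁻ y in cube x₀ R \ cube x₀ (2 ^ k * (2 * r)),
          ENNReal.ofReal A' * 2⁻¹ ^ k * ENNReal.ofReal R ^ (α - n)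
            * (‖b y - m‖ₑ * ‖f y‖ₑ) := by
          refine setLIntegral_mono' ((isClosed_cube _ _).measurableSet.diff
            (isClosed_cube _ _).measurableSet) fun y hy => ?_
          exact mul_le_mul' (hker y hy) le_rfl
      _ ≤ ∫⁻ y in cube x₀ R, ENNReal.ofReal A' * 2⁻¹ ^ k * ENNReal.ofReal R ^ (α - n)
            * (‖b y - m‖ₑ * ‖f y‖ₑ) := lintegral_mono_set Set.sdiff_subset
      _ = ENNReal.ofReal A' * 2⁻¹ ^ k * ENNReal.ofReal R ^ (α - n)
            * ∫⁻ y in cube x₀ R, ‖b y - m‖ₑ * ‖f y‖ₑ := by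
          refine lintegral_const_mul' _ _ (ENNReal.mul_ne_top (ENNReal.mul_ne_top
            ENNReal.ofReal_ne_top (ENNReal.pow_ne_top (by simp))) hRt)
      _ ≤ ENNReal.ofReal A' * 2⁻¹ ^ k * ENNReal.ofReal R ^ (α - n)
            * (dilatedOscillationConst n p * ((k + 1 : ℕ) + 1) * bmoNorm b *
              (volume (cube x₀ R) ^ (1 - 1 / η) *
                (∫⁻ y in cube x₀ R, ‖f y‖ₑ ^ η) ^ (1 / η))) := by
          gcongr
          exact lintegral_dilate_mul_le hb hf hpη x₀ h2r (k + 1)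
      _ = ENNReal.ofReal A' * dilatedOscillationConst n p * bmoNorm b
            * (ENNReal.ofReal R ^ (α - n) * volume (cube x₀ R) ^ (1 - 1 / η) *
                (∫⁻ y in cube x₀ R, ‖f y‖ₑ ^ η) ^ (1 / η))
            * (((k : ℝ≥0∞) + 2) * 2⁻¹ ^ k) := by
          rw [show (((k + 1 : ℕ) : ℝ≥0∞) + 1) = (k : ℝ≥0∞) + 2 by push_cast; ring]
          ring
      _ ≤ _ := by
          gcongr
          exact rpow_mul_lintegral_le_fracMax hη0 hn f hR (cube_subset_cube x₀ hrR hx)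
  have hdiff : fracInt Ω α g x - fracInt Ω α g x₀
      = ∫ y, (Ω (x - y) * ‖x - y‖ ^ (α - n) * g y - Ω (x₀ - y) * ‖x₀ - y‖ ^ (α - n) * g y) :=
    (integral_sub hint hint₀).symm
  calc _ = ‖fracInt Ω α g x - fracInt Ω α g x₀‖ₑ := (Real.enorm_eq_ofReal_abs _).symm
    _ ≤ ∫⁻ y, ‖Ω (x - y) * ‖x - y‖ ^ (α - n) * g y
          - Ω (x₀ - y) * ‖x₀ - y‖ ^ (α - n) * g y‖ₑ := by
        rw [hdiff]; exact enorm_integral_le_lintegral_enorm _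
    _ = ∫⁻ y in (cube x₀ (2 * r))ᶜ, I y := by
        rw [← lintegral_indicator (isClosed_cube _ _).measurableSet.compl]
        refine lintegral_congr fun y => ?_
        rw [← sub_mul, enorm_mul, hg]
        by_cases hy : y ∈ (cube x₀ (2 * r))ᶜ
        · rw [Set.indicator_of_mem hy, Set.indicator_of_mem hy, enorm_mul]
        · rw [Set.indicator_of_notMem hy, Set.indicator_of_notMem hy]; simp
    _ ≤ ∫⁻ y in ⋃ k : ℕ, cube x₀ (2 ^ (k + 1) * (2 * r)) \ cube x₀ (2 ^ k * (2 * r)), I y :=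
        lintegral_mono_set (compl_cube_subset_iUnion x₀ h2r)
    _ ≤ ∑' k : ℕ, ∫⁻ y in cube x₀ (2 ^ (k + 1) * (2 * r)) \ cube x₀ (2 ^ k * (2 * r)), I y :=
        lintegral_iUnion_le _ _
    _ ≤ ∑' k : ℕ, ENNReal.ofReal A' * dilatedOscillationConst n p * bmoNorm b * Fm
        * (((k : ℝ≥0∞) + 2) * 2⁻¹ ^ k) := ENNReal.tsum_le_tsum hlayer
    _ = C₀ * bmoNorm b * Fm := by rw [ENNReal.tsum_mul_left, hC₀]; ring
    _ ≤ _ := by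
        gcongr
        rw [ENNReal.ofReal_add ENNReal.toReal_nonneg (by norm_num), ENNReal.ofReal_toReal hC₀t]
        exact le_self_add

end
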